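/- Let P ⊂ ℝ^n be a full-dimensional smooth lattice polytope that is canonically positioned, contained in {x : 0 ≤ x_1 ≤ 1}, and such that every vertex of P has first coordinate equal to 0 or 1 (i.e., P is a Cayley polytope of order 1 with altitude in direction e_1). If the segment joining e_1 to e_2 is an edge of P, then the face P_1 := P ∩ {x : x_1 = 1} has dimension at most n − 2, and moreover P ⊆ {x : 0 ≤ x_2 ≤ 1}, so that P is also a Cayley polytope of order 1 with altitude in direction e_2. -/

import Mathlib

open Set

/-- The real point corresponding to an integer lattice point. -/
def toR {n : ℕ} (v : Fin n → ℤ) : Fin n → ℝ := fun i => (v i : ℝ)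

/-- `P` is a lattice polytope: the convex hull of a finite set of integer points. -/
def IsLatticePolytope {n : ℕ} (P : Set (Fin n → ℝ)) : Prop :=
  ∃ S : Finset (Fin n → ℤ), P = convexHull ℝ (toR '' (S : Set (Fin n → ℤ)))

/-- `P` is full-dimensional: its affine span is everything. -/
def IsFullDim {n : ℕ} (P : Set (Fin n → ℝ)) : Prop :=
  affineSpan ℝ P = ⊤

/-- A vertex of `P` is an extreme point of `P`. -/
def IsVertex {n : ℕ} (P : Set (Fin n → ℝ)) (v : Fin n → ℝ) : Prop :=
  v ∈ Set.extremePoints ℝ P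

/-- The segment from `a` to `b` (distinct integer points) is an edge of `P`,
i.e. an exposed face of `P` which is a segment. -/
def IsEdge {n : ℕ} (P : Set (Fin n → ℝ)) (a b : Fin n → ℤ) : Prop :=
  a ≠ b ∧ IsExposed ℝ P (segment ℝ (toR a) (toR b))

/-- The lattice length of an integer vector: the gcd of its entries. -/
def latticeLength {n : ℕ} (v : Fin n → ℤ) : ℕ :=
  Finset.univ.gcd fun i => (v i).natAbs

/-- The primitive integer vector in the direction of `v`. -/
def primVec {n : ℕ} (v : Fin n → ℤ) : Fin n → ℤ :=
  fun i => v i / (latticeLength v : ℤ)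

/-- `P` is smooth at the integer vertex `v`: there are exactly `n` edges through `v`
and the primitive directions of these edges form a `ℤ`-basis of `ℤⁿ`. -/
def SmoothAtVertex {n : ℕ} (P : Set (Fin n → ℝ)) (v : Fin n → ℤ) : Prop :=
  ∃ b : Fin n → (Fin n → ℤ),
    Function.Injective b ∧
    (∀ i, IsEdge P v (b i)) ∧
    (∀ c : Fin n → ℤ, IsEdge P v c →
      ∃ i, segment ℝ (toR v) (toR c) = segment ℝ (toR v) (toR (b i))) ∧
    IsUnit (Matrix.det (Matrix.of fun i => primVec (b i - v)))

/-- `P` is a full-dimensional smooth lattice polytope. -/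
def IsSmoothPolytope {n : ℕ} (P : Set (Fin n → ℝ)) : Prop :=
  IsLatticePolytope P ∧ IsFullDim P ∧
    ∀ v : Fin n → ℤ, IsVertex P (toR v) → SmoothAtVertex P v

/-- Every edge of `P` has lattice length at least `k`. -/
def EdgesAtLeast {n : ℕ} (P : Set (Fin n → ℝ)) (k : ℕ) : Prop :=
  ∀ a b : Fin n → ℤ, IsEdge P a b → k ≤ latticeLength (b - a)

/-- `P` is a Cayley polytope of order `k` with altitude in direction `eᵢ`:
`P ⊆ {x : 0 ≤ xᵢ ≤ k}` and every vertex of `P` has `i`-th coordinate `0` or `k`. -/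
def IsCayley {n : ℕ} (P : Set (Fin n → ℝ)) (k : ℕ) (i : Fin n) : Prop :=
  (∀ x ∈ P, 0 ≤ x i ∧ x i ≤ (k : ℝ)) ∧
  (∀ v : Fin n → ℝ, IsVertex P v → v i = 0 ∨ v i = (k : ℝ))

/-- `P` is canonically positioned: `0` is a vertex and for each `i` there is an
edge of `P` contained in the nonnegative `xᵢ`-coordinate axis. -/
def CanonicallyPositioned {n : ℕ} (P : Set (Fin n → ℝ)) : Prop :=
  IsVertex P 0 ∧
  ∀ i : Fin n, ∃ a b : Fin n → ℤ, IsEdge P a b ∧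
    segment ℝ (toR a) (toR b) ⊆ {x | 0 ≤ x i ∧ ∀ j, j ≠ i → x j = 0}

/-- `F` is a facet of `P`: an exposed face of dimension `n - 1`. -/
def IsFacet {n : ℕ} (P F : Set (Fin n → ℝ)) : Prop :=
  IsExposed ℝ P F ∧ Module.finrank ℝ (affineSpan ℝ F).direction = n - 1

/-- The lattice width of `Q`: the minimum over nonzero integer functionals `φ` of
`max_{x ∈ Q} ⟨φ, x⟩ - min_{x ∈ Q} ⟨φ, x⟩`. -/
noncomputable def latticeWidth {n : ℕ} (Q : Set (Fin n → ℝ)) : ℝ :=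
  ⨅ φ : {φ : Fin n → ℤ // φ ≠ 0},
    (sSup ((fun x => ∑ i, (φ.1 i : ℝ) * x i) '' Q) -
      sInf ((fun x => ∑ i, (φ.1 i : ℝ) * x i) '' Q))

/-- A vertex of a polytope is strictly exposed among the generating points. -/
lemma exists_pos_on_generators {n : ℕ} {S : Set (Fin n → ℝ)} (hS : S.Finite) {v : Fin n → ℝ}
    (hv : v ∈ (convexHull ℝ S).extremePoints ℝ) :
    ∃ h : StrongDual ℝ (Fin n → ℝ), ∀ w ∈ S, w ≠ v → 0 < h (w - v) := by
  have hnot : v ∉ convexHull ℝ (S \ {v}) := fun hmem =>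
    (((convex_convexHull ℝ S).mem_extremePoints_iff_mem_sdiff_convexHull_sdiff).1 hv).2
      (convexHull_mono (sdiff_subset_sdiff_left (subset_convexHull ℝ S)) hmem)
  obtain ⟨h, u, hvu, hu⟩ := geometric_hahn_banach_point_closed (convex_convexHull ℝ _)
    ((hS.sdiff (t := {v})).isClosed_convexHull ℝ) hnot
  refine ⟨h, fun w hw hwv => ?_⟩
  have := hu w (subset_convexHull ℝ _ ⟨hw, hwv⟩)
  rw [map_sub]
  linarith

/-- A finite set on which `l` is somewhere positive has a point, with `l` positive there, that is
the unique maximizer of some linear functional. -/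
lemma exists_unique_maximizer {n : ℕ} {Y : Set (Fin n → ℝ)} (hY : Y.Finite)
    (l : StrongDual ℝ (Fin n → ℝ)) {y₁ : Fin n → ℝ} (hy₁ : y₁ ∈ Y) (hl : 0 < l y₁) :
    ∃ y₀ ∈ Y, 0 < l y₀ ∧
      ∃ d : StrongDual ℝ (Fin n → ℝ), ∀ y ∈ Y, y ≠ y₀ → d y < d y₀ := by
  obtain ⟨B, hB⟩ := (hY.image fun y => y ⬝ᵥ y).bddAbove
  replace hB : ∀ y ∈ Y, y ⬝ᵥ y ≤ B := fun y hy => hB ⟨y, hy, rfl⟩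
  have hnn : ∀ y : Fin n → ℝ, 0 ≤ y ⬝ᵥ y := fun y =>
    Finset.sum_nonneg fun i _ => mul_self_nonneg (y i)
  have hB0 : 0 ≤ B := (hnn y₁).trans (hB _ hy₁)
  set M : ℝ := (B + 1) / (2 * l y₁) with hM
  have hM0 : 0 < M := by positivity
  have hM1 : 2 * (M * l y₁) = B + 1 := by rw [hM]; field_simp
  obtain ⟨y₀, hy₀, hmax⟩ := hY.exists_maximalFor (fun y => y ⬝ᵥ y + 2 * (M * l y)) Y ⟨y₁, hy₁⟩
  replace hmax : ∀ y ∈ Y, y ⬝ᵥ y + 2 * (M * l y) ≤ y₀ ⬝ᵥ y₀ + 2 * (M * l y₀) := fun y hy =>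
    (le_total _ _).elim id fun h => hmax hy h
  refine ⟨y₀, hy₀, ?_, ∑ i, y₀ i • ContinuousLinearMap.proj i + M • l, fun y hy hne => ?_⟩
  · have h1 := hmax y₁ hy₁
    have h2 := hB y₀ hy₀
    have h3 := hnn y₁
    have : 0 < M * l y₀ := by linarith
    exact pos_of_mul_pos_right this hM0.le
  · have h1 := hmax y hy
    have h2 : 0 < (y - y₀) ⬝ᵥ (y - y₀) :=
      lt_of_le_of_ne (hnn _) fun h => hne (sub_eq_zero.1 (dotProduct_self_eq_zero.1 h.symm))
    rw [sub_dotProduct, dotProduct_sub, dotProduct_sub, dotProduct_comm y y₀] at h2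
    have h3 : ∀ x, (∑ i, y₀ i • (ContinuousLinearMap.proj i : StrongDual ℝ (Fin n → ℝ)) + M • l) x
        = y₀ ⬝ᵥ x + M * l x := fun x => by
      simp [dotProduct]
    rw [h3, h3]
    linarith

/-- If the maximum of `g` over the generators is attained at `v` and otherwise only on the segment
from `v` to `w`, then that segment is an exposed face. -/
lemma isExposed_segment_of_generators {n : ℕ} {S : Set (Fin n → ℝ)} {v w : Fin n → ℝ}
    (hv : v ∈ S) (hw : w ∈ S) (g : StrongDual ℝ (Fin n → ℝ)) (hgw : g w = g v)
    (hg : ∀ x ∈ S, g x < g v ∨ x ∈ segment ℝ v w) :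
    IsExposed ℝ (convexHull ℝ S) (segment ℝ v w) := by
  have hseg : ∀ x ∈ segment ℝ v w, g x = g v := by
    rintro x ⟨a, b, -, -, hab, rfl⟩
    simp only [map_add, map_smul, smul_eq_mul, hgw]
    rw [← add_mul, hab, one_mul]
  have hsub : convexHull ℝ S ⊆ {x | g x < g v ∨ x ∈ segment ℝ v w} := by
    refine convexHull_min hg fun x hx y hy a b ha hb hab => ?_
    rcases ha.eq_or_lt with rfl | ha
    · simpa [show b = 1 by linarith] using hy
    rcases hb.eq_or_lt with rfl | hb
    · simpa [show a = 1 by linarith] using hx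
    have hle : ∀ z, z ∈ {x | g x < g v ∨ x ∈ segment ℝ v w} → g z ≤ g v := fun z hz =>
      hz.elim le_of_lt fun h => (hseg z h).le
    have hb' : b = 1 - a := by linarith
    rcases hx with hx' | hx'
    · left
      simp only [map_add, map_smul, smul_eq_mul]
      have := hle y hy
      subst hb'
      nlinarith
    rcases hy with hy' | hy'
    · left
      simp only [map_add, map_smul, smul_eq_mul, hseg x hx']
      subst hb'
      nlinarith
    · exact Or.inr (convex_segment v w hx' hy' ha.le hb.le hab)
  have hle : ∀ x ∈ convexHull ℝ S, g x ≤ g v := fun x hx =>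
    (hsub hx).elim le_of_lt fun h => (hseg x h).le
  refine fun _ => ⟨g, Subset.antisymm (fun x hx => ⟨?_, fun y hy => ?_⟩) fun x hx => ?_⟩
  · exact (convex_convexHull ℝ S).segment_subset (subset_convexHull ℝ S hv)
      (subset_convexHull ℝ S hw) hx
  · rw [hseg x hx]; exact hle y hy
  · exact (hsub hx.1).resolve_left (hx.2 v (subset_convexHull ℝ S hv)).not_gt

/-- If a linear functional is not maximal at a vertex of a polytope, then it increases along some
edge through this vertex. -/
lemma exists_improving_edge {n : ℕ} {S : Set (Fin n → ℝ)} (hS : S.Finite) {v : Fin n → ℝ}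
    (hv : v ∈ (convexHull ℝ S).extremePoints ℝ) (l : StrongDual ℝ (Fin n → ℝ))
    {x : Fin n → ℝ} (hx : x ∈ convexHull ℝ S) (hl : l v < l x) :
    ∃ w ∈ S, l v < l w ∧ IsExposed ℝ (convexHull ℝ S) (segment ℝ v w) := by
  obtain ⟨w₁, hw₁, hlw₁⟩ : ∃ w ∈ S, l v < l w := by
    by_contra! hcon
    exact hl.not_ge (convexHull_min (t := {y | l y ≤ l v}) hcon
      (convex_halfSpace_le l.toLinearMap.isLinear (l v)) hx)
  have hvS : v ∈ S := extremePoints_convexHull_subset hv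
  obtain ⟨h, hh⟩ := exists_pos_on_generators hS hv
  have hne : ∀ {w}, l v < l w → w ≠ v := fun hw h => hw.ne (by rw [h])
  let r : (Fin n → ℝ) → (Fin n → ℝ) := fun w => (h (w - v))⁻¹ • (w - v)
  have hr : ∀ w ∈ S, w ≠ v → w - v = h (w - v) • r w := fun w hw hwv => by
    simp only [r]
    rw [smul_smul, mul_inv_cancel₀ (hh w hw hwv).ne', one_smul]
  have hY : (r '' (S \ {v})).Finite := (hS.sdiff).image r
  obtain ⟨y₀, ⟨w₂, ⟨hw₂, hw₂v⟩, hy₀⟩, hly₀, d, hd⟩ :=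
    exists_unique_maximizer hY l (y₁ := r w₁) ⟨w₁, ⟨hw₁, hne hlw₁⟩, rfl⟩ (by
      simp only [r, map_smul, smul_eq_mul, map_sub l]
      exact mul_pos (inv_pos.2 (hh _ hw₁ (hne hlw₁))) (sub_pos.2 hlw₁))
  obtain ⟨w, ⟨⟨hwS, hwv⟩, hwy⟩, hwmax⟩ :=
    (hS.subset (s := S) (t := {w | (w ∈ S ∧ w ≠ v) ∧ r w = y₀}) fun w hw => hw.1.1).exists_maximalFor
      (fun w => h (w - v)) _ ⟨w₂, ⟨hw₂, hw₂v⟩, hy₀⟩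
  have hpos := hh w hwS hwv
  have key : ∀ z ∈ S, z ≠ v → d z - d v = h (z - v) * d (r z) := fun z hz hzv => by
    rw [← map_sub, ← smul_eq_mul, ← map_smul, ← hr z hz hzv]
  have hrh : ∀ z, h z - h v = h (z - v) := fun z => (map_sub h z v).symm
  refine ⟨w, hwS, ?_, isExposed_segment_of_generators hvS hwS (d - d y₀ • h) ?_ fun z hz => ?_⟩
  · have : l w - l v = h (w - v) * l y₀ := by
      rw [← hwy, ← map_sub, ← smul_eq_mul, ← map_smul, ← hr w hwS hwv]
    nlinarith [mul_pos hpos hly₀]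
  · have h1 := key w hwS hwv
    rw [hwy, ← hrh] at h1
    simp only [sub_apply, smul_apply, smul_eq_mul]
    linarith
  · by_cases hzv : z = v
    · exact Or.inr (hzv ▸ left_mem_segment ℝ v w)
    by_cases hzy : r z = y₀
    · right
      have hz0 := hh z hz hzv
      have hle : h (z - v) ≤ h (w - v) :=
        (le_total _ _).elim id fun h' => hwmax (j := z) ⟨⟨hz, hzv⟩, hzy⟩ h'
      rw [segment_eq_image']
      refine ⟨h (z - v) / h (w - v), ⟨by positivity, (div_le_one hpos).2 hle⟩, ?_⟩
      change v + (h (z - v) / h (w - v)) • (w - v) = z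
      have h1 := hr w hwS hwv
      have h2 := hr z hz hzv
      rw [hwy] at h1
      rw [hzy] at h2
      conv_lhs => rw [show w - v = h (w - v) • y₀ from h1]
      rw [map_smul, show h y₀ = 1 from ?_, smul_smul, smul_eq_mul, mul_one,
        div_mul_cancel₀ _ hpos.ne', ← h2, add_sub_cancel]
      rw [← hwy]
      simp only [r]
      rw [map_smul, smul_eq_mul, inv_mul_cancel₀ hpos.ne']
    · left
      have h1 := key z hz hzv
      have h2 := hd (r z) ⟨z, ⟨hz, hzv⟩, rfl⟩ hzy
      have h3 := mul_lt_mul_of_pos_left h2 (hh z hz hzv)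
      rw [← h1, ← hrh] at h3
      simp only [sub_apply, smul_apply, smul_eq_mul]
      linarith

lemma toR_injective {n : ℕ} : Function.Injective (toR (n := n)) := fun _ _ h =>
  funext fun i => Int.cast_injective (congrFun h i)

lemma segment_right_injective {n : ℕ} (v : Fin n → ℝ) :
    Function.Injective fun w => segment ℝ v w := fun b c h => by
  refine (wbtw_swap_right_iff ℝ v).1 ⟨?_, ?_⟩ <;>
    rw [Wbtw, affineSegment_eq_segment]
  · exact (show segment ℝ v b = segment ℝ v c from h) ▸ right_mem_segment ℝ v b
  · exact (show segment ℝ v b = segment ℝ v c from h) ▸ right_mem_segment ℝ v c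

lemma left_mem_extremePoints_segment {n : ℕ} (v w : Fin n → ℝ) :
    v ∈ (segment ℝ v w).extremePoints ℝ := by
  by_contra hv
  have hsub : (segment ℝ v w).extremePoints ℝ ⊆ {w} := fun x hx => by
    rw [← convexHull_pair] at hx
    rcases extremePoints_convexHull_subset hx with rfl | h
    · rw [convexHull_pair] at hx
      exact absurd hx hv
    · exact h
  have hcpt : IsCompact (segment ℝ v w) := by
    rw [← convexHull_pair]
    exact (toFinite {v, w}).isCompact_convexHull ℝ
  have hcl := closure_convexHull_extremePoints hcpt (convex_segment v w)
  have : v ∈ closure (convexHull ℝ ((segment ℝ v w).extremePoints ℝ)) :=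
    hcl.symm.subset (left_mem_segment ℝ v w)
  have hvw : v ∈ ({w} : Set (Fin n → ℝ)) := by
    have := closure_mono (convexHull_mono hsub) this
    rwa [convexHull_singleton, closure_singleton] at this
  obtain rfl : v = w := hvw
  exact hv (by simp)

namespace IsEdge

variable {n : ℕ} {P : Set (Fin n → ℝ)} {a b : Fin n → ℤ}

lemma symm (h : IsEdge P a b) : IsEdge P b a :=
  ⟨h.1.symm, segment_symm ℝ (toR a) (toR b) ▸ h.2⟩

lemma segment_subset (h : IsEdge P a b) : segment ℝ (toR a) (toR b) ⊆ P :=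
  IsExposed.subset h.2

lemma left_mem (h : IsEdge P a b) : toR a ∈ P :=
  h.segment_subset (left_mem_segment ℝ _ _)

lemma right_mem (h : IsEdge P a b) : toR b ∈ P :=
  h.symm.left_mem

lemma isVertex_left (h : IsEdge P a b) : IsVertex P (toR a) :=
  h.2.isExtreme.extremePoints_subset_extremePoints (left_mem_extremePoints_segment _ _)

end IsEdge

namespace IsLatticePolytope

variable {n : ℕ} {P : Set (Fin n → ℝ)}

lemma isCompact (hP : IsLatticePolytope P) : IsCompact P := by
  obtain ⟨S, rfl⟩ := hP
  exact (S.finite_toSet.image toR).isCompact_convexHull ℝ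

lemma exists_toR_eq_of_isVertex (hP : IsLatticePolytope P) {v : Fin n → ℝ} (hv : IsVertex P v) :
    ∃ w, toR w = v := by
  obtain ⟨S, rfl⟩ := hP
  obtain ⟨w, -, hw⟩ := extremePoints_convexHull_subset hv
  exact ⟨w, hw⟩

/-- A linear functional that does not increase along the edges through a vertex is maximal at this
vertex. -/
lemma le_of_forall_isEdge (hP : IsLatticePolytope P) {v : Fin n → ℤ} (hv : IsVertex P (toR v))
    (l : StrongDual ℝ (Fin n → ℝ)) (hl : ∀ b, IsEdge P v b → l (toR b) ≤ l (toR v)) :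
    ∀ x ∈ P, l x ≤ l (toR v) := by
  obtain ⟨S, rfl⟩ := hP
  intro x hx
  by_contra! hlt
  obtain ⟨_, ⟨b, -, rfl⟩, hb, hexp⟩ := exists_improving_edge (S.finite_toSet.image toR) hv l hx hlt
  exact hb.not_ge (hl b ⟨fun h => hb.ne (by rw [h]), hexp⟩)

end IsLatticePolytope

/-- Any `n` distinct edges through a smooth vertex are all the edges through this vertex. -/
lemma SmoothAtVertex.exists_eq_of_injective {n : ℕ} {P : Set (Fin n → ℝ)} {v : Fin n → ℤ}
    (h : SmoothAtVertex P v) {c : Fin n → Fin n → ℤ} (hc : Function.Injective c)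
    (hcP : ∀ i, IsEdge P v (c i)) {b : Fin n → ℤ} (hb : IsEdge P v b) : ∃ i, b = c i := by
  obtain ⟨e, -, -, he, -⟩ := h
  have he' : ∀ w, IsEdge P v w → ∃ i, w = e i := fun w hw =>
    (he w hw).imp fun i hi => toR_injective (segment_right_injective _ hi)
  choose k hk using fun i => he' (c i) (hcP i)
  have hkinj : Function.Injective k := fun i j hij => hc (by rw [hk, hk, hij])
  obtain ⟨j, hj⟩ := he' b hb
  obtain ⟨i, rfl⟩ := Finite.surjective_of_injective hkinj j
  exact ⟨i, by rw [hj, hk]⟩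

lemma toR_zero {n : ℕ} : toR (0 : Fin n → ℤ) = 0 := by
  ext; simp [toR]

namespace CanonicallyPositioned

variable {n : ℕ} {P : Set (Fin n → ℝ)}

/-- The edges of a canonically positioned polytope on the coordinate axes start at the origin. -/
lemma exists_isEdge_zero (hpos : CanonicallyPositioned P) (i : Fin n) :
    ∃ c : Fin n → ℤ, IsEdge P 0 c ∧ 0 < c i ∧ ∀ j, j ≠ i → c j = 0 := by
  obtain ⟨a, b, hab, hsub⟩ := hpos.2 i
  have ha := hsub (left_mem_segment ℝ _ _)
  have hb := hsub (right_mem_segment ℝ _ _)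
  have axis : ∀ c : Fin n → ℤ, (0 ≤ toR c i ∧ ∀ j, j ≠ i → toR c j = 0) →
      0 ≤ c i ∧ ∀ j, j ≠ i → c j = 0 := fun c hc =>
    ⟨Int.cast_nonneg_iff.1 hc.1, fun j hj => Int.cast_eq_zero.1 (hc.2 j hj)⟩
  have ha' := axis a ha
  have hb' := axis b hb
  have posi : ∀ c : Fin n → ℤ, 0 ≤ c i ∧ (∀ j, j ≠ i → c j = 0) → c ≠ 0 → 0 < c i :=
    fun c hc hne => hc.1.lt_of_ne fun h => hne <| funext fun j => by
      by_cases hj : j = i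
      · rw [hj, ← h]; rfl
      · exact hc.2 j hj
  by_cases ha0 : a = 0
  · subst ha0
    exact ⟨b, hab, posi b hb' hab.1.symm, hb'.2⟩
  by_cases hb0 : b = 0
  · subst hb0
    exact ⟨a, hab.symm, posi a ha' hab.1, ha'.2⟩
  exfalso
  have hai := posi a ha' ha0
  have hbi := posi b hb' hb0
  have hne : a i ≠ b i := fun h => hab.1 <| funext fun j => by
    by_cases hj : j = i
    · rw [hj, h]
    · rw [ha'.2 j hj, hb'.2 j hj]
  obtain ⟨l, hl⟩ := hab.2 ⟨_, left_mem_segment ℝ _ _⟩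
  have hla := (hl ▸ left_mem_segment ℝ (toR a) (toR b)).2
  have hlb := (hl ▸ right_mem_segment ℝ (toR a) (toR b)).2
  have heq : l (toR a) = l (toR b) := le_antisymm (hlb _ hab.left_mem) (hla _ hab.right_mem)
  have form : ∀ c : Fin n → ℤ, (∀ j, j ≠ i → c j = 0) →
      toR c = (c i : ℝ) • Pi.single i (1 : ℝ) := fun c hc => funext fun j => by
    by_cases hj : j = i
    · subst hj; simp [toR]
    · simp [toR, hc j hj, hj]
  have hli : l (Pi.single i 1) = 0 := by
    rw [form a ha'.2, form b hb'.2, map_smul, map_smul, smul_eq_mul, smul_eq_mul] at heq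
    have : ((a i : ℝ) - b i) * l (Pi.single i 1) = 0 := by linarith
    exact (mul_eq_zero.1 this).resolve_left (sub_ne_zero.2 (by exact_mod_cast hne))
  have hl0 : l (toR a) = 0 := by rw [form a ha'.2, map_smul, hli, smul_zero]
  have h0 : (0 : Fin n → ℝ) ∈ segment ℝ (toR a) (toR b) := by
    rw [hl]
    refine ⟨extremePoints_subset hpos.1, fun y hy => ?_⟩
    rw [map_zero, ← hl0]
    exact hla y hy
  obtain ⟨s, t, hs, ht, hst, h⟩ := h0
  have hi : s * (a i : ℝ) + t * b i = 0 := congrFun h i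
  have h1 : (0 : ℝ) < a i := by exact_mod_cast hai
  have h2 : (0 : ℝ) < b i := by exact_mod_cast hbi
  rcases hs.eq_or_lt with rfl | hs
  · nlinarith
  · nlinarith [mul_pos hs h1, mul_nonneg ht h2.le]

/-- A canonically positioned smooth polytope lies in the nonnegative orthant. -/
lemma nonneg (hpos : CanonicallyPositioned P) (hP : IsSmoothPolytope P) {x : Fin n → ℝ}
    (hx : x ∈ P) (i : Fin n) : 0 ≤ x i := by
  have hv : IsVertex P (toR 0) := toR_zero ▸ hpos.1
  choose c hc hci hcj using hpos.exists_isEdge_zero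
  have hinj : Function.Injective c := fun j k hjk => by
    by_contra hne
    exact (hci j).ne' (hjk ▸ hcj k j hne)
  have := hP.1.le_of_forall_isEdge hv (-ContinuousLinearMap.proj i) (fun b hb => by
    obtain ⟨j, rfl⟩ := (hP.2.2 0 hv).exists_eq_of_injective hinj hc hb
    have : 0 ≤ c j i := by
      by_cases hij : i = j
      · exact hij ▸ (hci i).le
      · exact (hcj j i hij).ge
    simpa [toR] using this) x hx
  simpa [toR] using this

/-- If `eᵢ` is a vertex, then for every other coordinate `j` there is an edge through `eᵢ` in the
`xᵢxⱼ`-plane that leaves the `xᵢ`-axis. -/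
lemma exists_isEdge_single (hpos : CanonicallyPositioned P) (hP : IsSmoothPolytope P)
    {i j : Fin n} (hv : IsVertex P (toR (Pi.single i 1))) (hj : j ≠ i) :
    ∃ b : Fin n → ℤ, IsEdge P (Pi.single i 1) b ∧ 0 < b j ∧ ∀ m, m ≠ i → m ≠ j → b m = 0 := by
  by_contra! hcon
  obtain ⟨M, hM⟩ := (hP.1.isCompact.image (continuous_apply j)).bddAbove
  replace hM : ∀ x ∈ P, x j ≤ M := fun x hx => hM ⟨x, hx, rfl⟩
  obtain ⟨c, hc, hcj, hc0⟩ := hpos.exists_isEdge_zero j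
  let s : Finset (Fin n) := {m | m ≠ i ∧ m ≠ j}
  let l : StrongDual ℝ (Fin n → ℝ) :=
    ContinuousLinearMap.proj j - M • ∑ m ∈ s, ContinuousLinearMap.proj m
  have hl : ∀ x, l x = x j - M * ∑ m ∈ s, x m := fun x => by simp [l]
  have hM0 : 0 ≤ M := (hpos.nonneg hP hc.left_mem j).trans (hM _ hc.left_mem)
  have hlv : l (toR (Pi.single i 1)) = 0 := by
    rw [hl, Finset.sum_eq_zero fun m hm => ?_]
    · simp [toR, hj]
    · simp [toR, (Finset.mem_filter.1 hm).2.1]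
  have hlc : l (toR c) = c j := by
    rw [hl, Finset.sum_eq_zero fun m hm => ?_]
    · simp [toR]
    · simp [toR, hc0 m (Finset.mem_filter.1 hm).2.2]
  have hle := hP.1.le_of_forall_isEdge hv l (fun b hb => ?_) (toR c) hc.right_mem
  · rw [hlc, hlv] at hle
    exact hcj.not_ge (by exact_mod_cast hle)
  have hb0 : ∀ m, 0 ≤ toR b m := hpos.nonneg hP hb.right_mem
  have hsum : ∀ m ∈ s, 0 ≤ toR b m := fun m _ => hb0 m
  rw [hlv, hl]
  by_cases hbj : 0 < b j
  · obtain ⟨m, hmi, hmj, hm⟩ := hcon b hb hbj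
    have h1 : (1 : ℝ) ≤ toR b m := by
      have : 0 ≤ b m := Int.cast_nonneg_iff.1 (hb0 m)
      exact Int.cast_one_le_of_pos (show 0 < b m by omega)
    have h2 := Finset.single_le_sum hsum (by simp [s, hmi, hmj] : m ∈ s)
    nlinarith [hM _ hb.right_mem]
  · have h1 : toR b j ≤ 0 := Int.cast_nonpos.2 (not_lt.1 hbj)
    nlinarith [mul_nonneg hM0 (Finset.sum_nonneg hsum)]

/-- If `[eᵢ, 0]` and `[eᵢ, eⱼ]` are edges of a canonically positioned smooth polytope contained in
`{x | xᵢ ≤ 1}`, then the polytope is contained in `{x | xᵢ + xⱼ ≤ 1}`. -/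
lemma add_le_one (hpos : CanonicallyPositioned P) (hP : IsSmoothPolytope P) {i j : Fin n}
    (hij : j ≠ i) (hle : ∀ x ∈ P, x i ≤ 1) (h0 : IsEdge P (Pi.single i 1) 0)
    (hE : IsEdge P (Pi.single i 1) (Pi.single j 1)) {x : Fin n → ℝ} (hx : x ∈ P) :
    x i + x j ≤ 1 := by
  have hk : ∀ k : Fin n, ∃ b : Fin n → ℤ, IsEdge P (Pi.single i 1) b ∧ (k ≠ i → 0 < b k) ∧
      (∀ m, m ≠ i → m ≠ k → b m = 0) ∧ (k = i → b = 0) ∧ (k = j → b = Pi.single j 1) := by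
    intro k
    by_cases hki : k = i
    · exact ⟨0, h0, by simp [hki], by simp, by simp, fun h => absurd (h.symm.trans hki) hij⟩
    by_cases hkj : k = j
    · refine ⟨Pi.single j 1, hE, fun _ => by simp [hkj], fun m _ hm => ?_, by simp [hki], by simp⟩
      simp [hkj ▸ hm]
    · obtain ⟨b, hb, hbk, hbm⟩ := hpos.exists_isEdge_single hP hE.isVertex_left hki
      exact ⟨b, hb, fun _ => hbk, hbm, by simp [hki], by simp [hkj]⟩
  choose c hc hck hcm hci hcj using hk
  have hne : ∀ k m, k ≠ m → k ≠ i → c k ≠ c m := fun k m hkm hki h =>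
    (hck k hki).ne' (h ▸ hcm m k hki hkm)
  have hinj : Function.Injective c := fun k m h => by
    by_contra hkm
    by_cases hki : k = i
    · exact hne m k (Ne.symm hkm) (fun hmi => hkm (hki.trans hmi.symm)) h.symm
    · exact hne k m hkm hki h
  have := hP.1.le_of_forall_isEdge hE.isVertex_left
    (ContinuousLinearMap.proj i + ContinuousLinearMap.proj j) (fun b hb => by
      obtain ⟨k, rfl⟩ := (hP.2.2 _ hE.isVertex_left).exists_eq_of_injective hinj hc hb
      have h1 : toR (Pi.single i 1) i + toR (Pi.single i 1) j = 1 := by simp [toR, hij]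
      rw [add_apply, add_apply]
      change toR (c k) i + toR (c k) j ≤ toR (Pi.single i 1) i + toR (Pi.single i 1) j
      rw [h1]
      by_cases hki : k = i
      · simp [hci k hki, toR]
      by_cases hkj : k = j
      · simp [hcj k hkj, toR, hij.symm]
      · have : toR (c k) j = 0 := by simp [toR, hcm k j hij (Ne.symm hkj)]
        rw [this, add_zero]
        exact hle _ hb.right_mem) x hx
  simpa [toR, hij] using this

/-- If `P` is a Cayley polytope of order `1` in direction `eᵢ`, then `[eᵢ, 0]` is an edge. -/
lemma isEdge_single_zero (hpos : CanonicallyPositioned P) {i : Fin n}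
    (hle : ∀ x ∈ P, x i ≤ 1) : IsEdge P (Pi.single i 1) 0 := by
  obtain ⟨c, hc, hci, hcj⟩ := hpos.exists_isEdge_zero i
  have h1 : (c i : ℝ) ≤ 1 := hle _ hc.right_mem
  norm_cast at h1
  have : c = Pi.single i 1 := funext fun j => by
    by_cases hj : j = i
    · subst hj
      rw [Pi.single_eq_same]
      omega
    · simp [hcj j hj, hj]
  exact this ▸ hc.symm

end CanonicallyPositioned

/-- A set on which two coordinates are constant has dimension at most `n - 2`. -/
lemma finrank_direction_affineSpan_le {n : ℕ} {i j : Fin n} (hij : j ≠ i) {Q : Set (Fin n → ℝ)}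
    {a b : ℝ} (hi : ∀ x ∈ Q, x i = a) (hj : ∀ x ∈ Q, x j = b) :
    Module.finrank ℝ (affineSpan ℝ Q).direction ≤ n - 2 := by
  let f : (Fin n → ℝ) →ₗ[ℝ] ℝ × ℝ := (LinearMap.proj i).prod (LinearMap.proj j)
  have hf : LinearMap.range f = ⊤ := LinearMap.range_eq_top.2 fun y =>
    ⟨Pi.single i y.1 + Pi.single j y.2, by ext <;> simp [f, hij, hij.symm]⟩
  have hrk := f.finrank_range_add_finrank_ker
  rw [hf, finrank_top, Module.finrank_prod, Module.finrank_self, Module.finrank_fin_fun] at hrk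
  have hsub : (affineSpan ℝ Q).direction ≤ LinearMap.ker f := by
    rw [direction_affineSpan, vectorSpan, Submodule.span_le]
    rintro _ ⟨x, hx, y, hy, rfl⟩
    simp [f, hi x hx, hi y hy, hj x hx, hj y hy]
  have := Submodule.finrank_mono hsub
  omega

/-- (Lemma 3.5 of the paper.) Let `P ⊂ ℝⁿ` be a full-dimensional smooth
lattice polytope, canonically positioned, which is a Cayley polytope of order `1` with
altitude in direction `e₁`. If the segment from `e₁` to `e₂` is an edge of `P`, then the
face `P₁ = P ∩ {x₁ = 1}` has dimension at most `n - 2`, and `P` is also a Cayley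
polytope of order `1` with altitude in direction `e₂`. -/
theorem stmt_4 {n : ℕ} (hn : 2 ≤ n) (P : Set (Fin n → ℝ))
    (hP : IsSmoothPolytope P) (hpos : CanonicallyPositioned P)
    (hCay : IsCayley P 1 ⟨0, by omega⟩)
    (hEdge : IsEdge P (Pi.single (⟨0, by omega⟩ : Fin n) (1 : ℤ))
      (Pi.single (⟨1, by omega⟩ : Fin n) (1 : ℤ))) :
    Module.finrank ℝ (affineSpan ℝ (P ∩ {x | x ⟨0, by omega⟩ = 1})).direction ≤ n - 2 ∧
    IsCayley P 1 ⟨1, by omega⟩ := by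
  have hle : ∀ x ∈ P, x ⟨0, by omega⟩ ≤ 1 := fun x hx => by exact_mod_cast (hCay.1 x hx).2
  have hij : (⟨1, by omega⟩ : Fin n) ≠ ⟨0, by omega⟩ := by simp
  have hadd : ∀ x ∈ P, x ⟨0, by omega⟩ + x ⟨1, by omega⟩ ≤ 1 := fun x hx =>
    hpos.add_le_one hP hij hle (hpos.isEdge_single_zero hle) hEdge hx
  have hnonneg : ∀ x ∈ P, ∀ i, 0 ≤ x i := fun x hx => hpos.nonneg hP hx
  have hbound : ∀ x ∈ P, 0 ≤ x ⟨1, by omega⟩ ∧ x ⟨1, by omega⟩ ≤ ((1 : ℕ) : ℝ) := fun x hx => by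
    have h0 := hnonneg x hx ⟨0, by omega⟩
    have h1 := hadd x hx
    exact ⟨hnonneg x hx _, by rw [Nat.cast_one]; linarith⟩
  refine ⟨finrank_direction_affineSpan_le (a := 1) (b := 0) hij (fun x hx => hx.2) fun x hx => ?_,
    hbound, fun v hv => ?_⟩
  · have h0 : x ⟨0, by omega⟩ = 1 := hx.2
    linarith [hadd x hx.1, hnonneg x hx.1 ⟨1, by omega⟩]
  · obtain ⟨h0, h1⟩ := hbound v (extremePoints_subset hv)
    obtain ⟨w, rfl⟩ := hP.1.exists_toR_eq_of_isVertex hv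
    have h0' : 0 ≤ w ⟨1, by omega⟩ := Int.cast_nonneg_iff.1 h0
    have h1' : w ⟨1, by omega⟩ ≤ 1 := Int.cast_le.1 (h1.trans_eq (by simp))
    have : w ⟨1, by omega⟩ = 0 ∨ w ⟨1, by omega⟩ = 1 := by omega
    exact this.imp (fun h => by simp [toR, h]) fun h => by simp [toR, h]
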